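/- Let m ∈ ℕ, let I : (0,∞) → (0,∞) be a non-decreasing left-continuous function such that Φ_I^m(t,s) is essentially decreasing in t, and let ‖·‖_X be a rearrangement-invariant Banach function norm on measurable functions on (0,∞). Then for every non-negative measurable f on (0,∞): ‖R_I^m f*‖_{X'_d} ≤ ‖R_I^m f*‖_{X'} ≤ ‖G_I^m f‖_{X'} ≤ 2^{m+1} ‖R_I^m f*‖_{X'_d}. -/

import Mathlib

open MeasureTheory Set Filter
open scoped ENNReal NNReal Topology

noncomputable section

/-- The distribution function of `f`, viewed as a function on `(0,∞)` with Lebesgue measure: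
`μ_f(s) = λ({t ∈ (0,∞) : f(t) > s})`. -/
def distrib (f : ℝ → ℝ≥0∞) (s : ℝ≥0∞) : ℝ≥0∞ :=
  volume {t : ℝ | t ∈ Set.Ioi (0 : ℝ) ∧ s < f t}

/-- The non-increasing rearrangement `f*(t) = inf { s ≥ 0 : μ_f(s) ≤ t }`. -/
def rearr (f : ℝ → ℝ≥0∞) (t : ℝ) : ℝ≥0∞ :=
  sInf {s : ℝ≥0∞ | distrib f s ≤ ENNReal.ofReal t}

/-- The operator `R_I f(t) = (1/I(t)) ∫_0^t f(s) ds`. -/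
def RI (I : ℝ → ℝ) (f : ℝ → ℝ≥0∞) : ℝ → ℝ≥0∞ :=
  fun t => (∫⁻ s in Set.Ioc (0 : ℝ) t, f s) / ENNReal.ofReal (I t)

/-- The operator `H_I f(t) = ∫_t^∞ f(s)/I(s) ds`. -/
def HI (I : ℝ → ℝ) (f : ℝ → ℝ≥0∞) : ℝ → ℝ≥0∞ :=
  fun t => ∫⁻ s in Set.Ioi t, f s / ENNReal.ofReal (I s)

/-- `G_I^m f(t) = sup_{s ≥ t} R_I^m f*(s)`. -/
def GI (I : ℝ → ℝ) (m : ℕ) (f : ℝ → ℝ≥0∞) : ℝ → ℝ≥0∞ :=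
  fun t => ⨆ s ∈ Set.Ici t, (RI I)^[m] (rearr f) s

/-- `Φ_I^m(t,s) = (∫_s^t 1/I(τ) dτ)^(m-1) / I(t)`. -/
def Phi (I : ℝ → ℝ) (m : ℕ) (t s : ℝ) : ℝ :=
  (∫ τ in s..t, 1 / I τ) ^ (m - 1) / I t

/-- `Φ_I^m(t,s)` is essentially decreasing in `t`. -/
def EssentiallyDecreasingIn (I : ℝ → ℝ) (m : ℕ) : Prop :=
  ∀ s₀ ∈ Set.Ioi (0 : ℝ), ∃ t₀ ∈ Set.Ioi (0 : ℝ), ∀ t ∈ Set.Ioi t₀,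
    ∃ rt ∈ Set.Ioi (0 : ℝ), ∀ r ∈ Set.Ioi rt, ∀ s ∈ Set.Ioo (0 : ℝ) s₀,
      Phi I m r s ≤ Phi I m t s

/-- The kernel operator `f ↦ (t ↦ ∫_t^∞ (f(s)/I(s)) (∫_t^s 1/I(r) dr)^(m-1) ds)`. -/
def kernelOp (I : ℝ → ℝ) (m : ℕ) (f : ℝ → ℝ≥0∞) : ℝ → ℝ≥0∞ :=
  fun t => ∫⁻ s in Set.Ioi t,
    (f s / ENNReal.ofReal (I s)) * (ENNReal.ofReal (∫ r in t..s, 1 / I r)) ^ (m - 1)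

/-- A Banach function norm on (non-negative) measurable functions on `(0,∞)`
(with Lebesgue measure). -/
structure BanachFunctionNorm where
  /-- The norm functional. -/
  N : (ℝ → ℝ≥0∞) → ℝ≥0∞
  /-- Positive homogeneity. -/
  smul : ∀ (c : ℝ≥0) (f : ℝ → ℝ≥0∞), Measurable f →
    N (fun t => (c : ℝ≥0∞) * f t) = (c : ℝ≥0∞) * N f
  /-- The norm vanishes exactly on a.e.-zero functions. -/
  eq_zero_iff : ∀ f : ℝ → ℝ≥0∞, Measurable f →
    (N f = 0 ↔ ∀ᵐ t ∂(volume.restrict (Set.Ioi (0 : ℝ))), f t = 0)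
  /-- Subadditivity. -/
  add_le : ∀ f g : ℝ → ℝ≥0∞, Measurable f → Measurable g →
    N (fun t => f t + g t) ≤ N f + N g
  /-- The lattice property. -/
  mono : ∀ f g : ℝ → ℝ≥0∞, Measurable f → Measurable g →
    (∀ᵐ t ∂(volume.restrict (Set.Ioi (0 : ℝ))), f t ≤ g t) → N f ≤ N g
  /-- The Fatou property: `f_n ↑ f` a.e. implies `‖f_n‖ ↑ ‖f‖`. -/
  fatou : ∀ (f : ℕ → ℝ → ℝ≥0∞) (g : ℝ → ℝ≥0∞), (∀ n, Measurable (f n)) →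
    Measurable g →
    (∀ᵐ t ∂(volume.restrict (Set.Ioi (0 : ℝ))), Monotone fun n => f n t) →
    (∀ᵐ t ∂(volume.restrict (Set.Ioi (0 : ℝ))), g t = ⨆ n, f n t) →
    N g = ⨆ n, N (f n)
  /-- Characteristic functions of sets of finite measure have finite norm. -/
  indicator_lt_top : ∀ E : Set ℝ, MeasurableSet E → E ⊆ Set.Ioi (0 : ℝ) →
    volume E < ∞ → N (E.indicator 1) < ∞
  /-- Local embedding into `L¹`. -/
  exists_integral_le : ∀ E : Set ℝ, MeasurableSet E → E ⊆ Set.Ioi (0 : ℝ) →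
    volume E < ∞ → ∃ C : ℝ≥0∞, C ≠ ∞ ∧
      ∀ f : ℝ → ℝ≥0∞, Measurable f → ∫⁻ t in E, f t ≤ C * N f

/-- A rearrangement-invariant Banach function norm: equimeasurable functions have
equal norms. -/
structure RIBanachFunctionNorm extends BanachFunctionNorm where
  /-- Rearrangement invariance. -/
  ri : ∀ f g : ℝ → ℝ≥0∞, Measurable f → Measurable g →
    (∀ s, distrib f s = distrib g s) → N f = N g

/-- The associate norm `‖f‖_{X'} = sup { ∫_0^∞ |f g| : ‖g‖_X ≤ 1 }`. -/
def assocNorm (X : RIBanachFunctionNorm) (f : ℝ → ℝ≥0∞) : ℝ≥0∞ :=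
  ⨆ (g : ℝ → ℝ≥0∞) (_ : Measurable g) (_ : X.N g ≤ 1),
    ∫⁻ t in Set.Ioi (0 : ℝ), f t * g t

/-- The down-associate norm `‖f‖_{X'_d} = sup { ∫_0^∞ |f| g* : ‖g‖_X ≤ 1 }`. -/
def downAssocNorm (X : RIBanachFunctionNorm) (f : ℝ → ℝ≥0∞) : ℝ≥0∞ :=
  ⨆ (g : ℝ → ℝ≥0∞) (_ : Measurable g) (_ : X.N g ≤ 1),
    ∫⁻ t in Set.Ioi (0 : ℝ), f t * rearr g t

theorem volume_ofReal_lt (d : ℝ≥0∞) :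
    volume {t : ℝ | t ∈ Ioi (0 : ℝ) ∧ ENNReal.ofReal t < d} = d := by
  induction d with
  | top =>
    have : {t : ℝ | t ∈ Ioi (0 : ℝ) ∧ ENNReal.ofReal t < ⊤} = Ioi 0 := by ext; simp
    rw [this, Real.volume_Ioi]
  | coe d =>
    have : {t : ℝ | t ∈ Ioi (0 : ℝ) ∧ ENNReal.ofReal t < d} = Ioo 0 (d : ℝ) := by
      ext t
      simp only [mem_ofPred_eq, mem_Ioi, mem_Ioo]
      refine and_congr_right fun ht => ?_
      rw [ENNReal.ofReal_lt_coe_iff ht.le]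
    rw [this, Real.volume_Ioo]
    simp

theorem distrib_antitone (f : ℝ → ℝ≥0∞) : Antitone (distrib f) := fun _ _ h =>
  measure_mono fun _ ht => ⟨ht.1, h.trans_lt ht.2⟩

theorem rearr_antitone (f : ℝ → ℝ≥0∞) : Antitone (rearr f) := fun _ _ h =>
  sInf_le_sInf fun _ hs => le_trans hs (ENNReal.ofReal_le_ofReal h)

theorem rearr_le_iff (f : ℝ → ℝ≥0∞) (t : ℝ) (s : ℝ≥0∞) :
    rearr f t ≤ s ↔ distrib f s ≤ ENNReal.ofReal t := by
  refine ⟨fun h => ?_, fun h => sInf_le h⟩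
  rcases eq_or_ne s ⊤ with rfl | hs
  · simp [distrib]
  obtain ⟨u, hu, hus, hlim⟩ := exists_seq_strictAnti_tendsto' (lt_top_iff_ne_top.2 hs)
  have hset : {t : ℝ | t ∈ Ioi (0 : ℝ) ∧ s < f t} =
      ⋃ n, {t : ℝ | t ∈ Ioi (0 : ℝ) ∧ u n < f t} := by
    ext x
    simp only [mem_ofPred_eq, mem_iUnion]
    constructor
    · rintro ⟨hx, hsx⟩
      obtain ⟨n, hn⟩ := (hlim.eventually (gt_mem_nhds hsx)).exists
      exact ⟨n, hx, hn⟩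
    · rintro ⟨n, hx, hn⟩
      exact ⟨hx, (hus n).1.trans hn⟩
  have hmono : Monotone fun n => {t : ℝ | t ∈ Ioi (0 : ℝ) ∧ u n < f t} :=
    fun i j hij x hx => ⟨hx.1, (hu.antitone hij).trans_lt hx.2⟩
  rw [distrib, hset, hmono.measure_iUnion]
  refine iSup_le fun n => ?_
  obtain ⟨v, hv, hvu⟩ := sInf_lt_iff.1 (h.trans_lt (hus n).1)
  exact (distrib_antitone f hvu.le).trans hv

theorem distrib_rearr (f : ℝ → ℝ≥0∞) (s : ℝ≥0∞) : distrib (rearr f) s = distrib f s := by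
  conv_rhs => rw [← volume_ofReal_lt (distrib f s)]
  rw [distrib]
  congr 1
  ext t
  simp only [mem_ofPred_eq]
  rw [← not_le, rearr_le_iff, not_le]

theorem norm_rearr (X : RIBanachFunctionNorm) {g : ℝ → ℝ≥0∞} (hg : Measurable g) :
    X.N (rearr g) = X.N g :=
  X.ri _ _ (rearr_antitone g).measurable hg (distrib_rearr g)

/-- The rearrangement of a non-increasing function dominates it almost everywhere. -/
theorem le_rearr_of_antitone {k : ℝ → ℝ≥0∞} (hk : Antitone k) :
    ∀ᵐ t ∂(volume.restrict (Ioi (0 : ℝ))), k t ≤ rearr k t := by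
  have hc : ∀ᵐ t : ℝ, ContinuousAt k t := by
    have := hk.countable_not_continuousAt.measure_zero volume
    simpa [ae_iff] using this
  filter_upwards [ae_restrict_of_ae hc, ae_restrict_mem measurableSet_Ioi] with t ht ht0
  refine le_of_tendsto (ht.tendsto.mono_left nhdsWithin_le_nhds : Tendsto k (𝓝[>] t) _) ?_
  filter_upwards [self_mem_nhdsWithin] with t' ht'
  refine le_sInf fun s hs => ?_
  by_contra! hlt
  have h1 : Ioc (0 : ℝ) t' ⊆ {t : ℝ | t ∈ Ioi (0 : ℝ) ∧ s < k t} :=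
    fun x hx => ⟨hx.1, hlt.trans_le (hk hx.2)⟩
  have h2 := (measure_mono h1).trans hs
  rw [Real.volume_Ioc, sub_zero, ENNReal.ofReal_le_ofReal_iff (le_of_lt ht0)] at h2
  exact absurd h2 (not_le.2 ht')

theorem lintegral_eq_lintegral_measure_lt {α : Type*} [MeasurableSpace α] (ν : Measure α)
    [SFinite ν] {F : α → ℝ≥0∞} (hF : Measurable F) :
    ∫⁻ x, F x ∂ν = ∫⁻ s in Ioi (0 : ℝ), ν {x | ENNReal.ofReal s < F x} := by
  have hm : MeasurableSet {p : α × ℝ | ENNReal.ofReal p.2 < F p.1} :=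
    measurableSet_lt (ENNReal.measurable_ofReal.comp measurable_snd) (hF.comp measurable_fst)
  calc ∫⁻ x, F x ∂ν
      = ∫⁻ x, (∫⁻ s in Ioi (0 : ℝ),
          {p : α × ℝ | ENNReal.ofReal p.2 < F p.1}.indicator 1 (x, s)) ∂ν := by
        refine lintegral_congr fun x => ?_
        conv_lhs => rw [← volume_ofReal_lt (F x)]
        have hx : MeasurableSet {s : ℝ | ENNReal.ofReal s < F x} :=
          measurableSet_lt ENNReal.measurable_ofReal measurable_const
        have : (fun s : ℝ => {p : α × ℝ | ENNReal.ofReal p.2 < F p.1}.indicator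
            (1 : α × ℝ → ℝ≥0∞) (x, s)) = {s : ℝ | ENNReal.ofReal s < F x}.indicator 1 := by
          ext s; simp [indicator]
        rw [this, lintegral_indicator_one hx, Measure.restrict_apply hx, inter_comm]
        rfl
    _ = ∫⁻ s in Ioi (0 : ℝ), (∫⁻ x,
          {p : α × ℝ | ENNReal.ofReal p.2 < F p.1}.indicator 1 (x, s) ∂ν) :=
        lintegral_lintegral_swap (measurable_one.indicator hm).aemeasurable
    _ = _ := by
        refine lintegral_congr fun s => ?_
        have hx : MeasurableSet {x : α | ENNReal.ofReal s < F x} :=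
          measurableSet_lt measurable_const hF
        rw [← lintegral_indicator_one hx]
        refine lintegral_congr fun x => ?_
        simp [indicator]

theorem setLIntegral_le_rearr {g : ℝ → ℝ≥0∞} (hg : Measurable g) {E : Set ℝ}
    (hE : MeasurableSet E) (hE0 : E ⊆ Ioi 0)
    (hlow : ∀ x ∈ E, ∀ y, 0 < y → y ≤ x → y ∈ E) :
    ∫⁻ t in E, g t ≤ ∫⁻ t in E, rearr g t := by
  rw [lintegral_eq_lintegral_measure_lt _ hg,
    lintegral_eq_lintegral_measure_lt _ (rearr_antitone g).measurable]
  refine lintegral_mono fun s => ?_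
  rw [Measure.restrict_apply' hE, Measure.restrict_apply' hE]
  set u := ENNReal.ofReal s
  by_cases hsub : E ⊆ {x | u < rearr g x}
  · rw [inter_eq_right.2 hsub]
    exact measure_mono inter_subset_right
  · obtain ⟨x, hxE, hx⟩ := not_subset.1 hsub
    have h1 : {t : ℝ | t ∈ Ioi (0 : ℝ) ∧ u < rearr g t} ⊆ {x | u < rearr g x} ∩ E := by
      rintro y ⟨hy0, hy⟩
      refine ⟨hy, hlow x hxE y hy0 ?_⟩
      by_contra! hxy
      exact hx (lt_of_lt_of_le hy (rearr_antitone g hxy.le))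
    calc volume ({x | u < g x} ∩ E) ≤ distrib g u :=
          measure_mono fun y hy => ⟨hE0 hy.2, hy.1⟩
      _ = distrib (rearr g) u := (distrib_rearr g u).symm
      _ ≤ _ := measure_mono h1

/-- The Hardy–Littlewood inequality with one non-increasing factor. -/
theorem lintegral_mul_le_lintegral_mul_rearr {F g : ℝ → ℝ≥0∞} (hF : Antitone F)
    (hg : Measurable g) :
    ∫⁻ t in Ioi (0 : ℝ), F t * g t ≤ ∫⁻ t in Ioi (0 : ℝ), F t * rearr g t := by
  have key : ∀ w : ℝ → ℝ≥0∞, Measurable w → ∫⁻ t in Ioi (0 : ℝ), F t * w t =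
      ∫⁻ s in Ioi (0 : ℝ), ∫⁻ t in {x | ENNReal.ofReal s < F x} ∩ Ioi 0, w t := by
    intro w hw
    have h1 : ∫⁻ t in Ioi (0 : ℝ), F t * w t =
        ∫⁻ t, F t ∂((volume.restrict (Ioi (0 : ℝ))).withDensity w) := by
      rw [lintegral_withDensity_eq_lintegral_mul _ hw hF.measurable]
      simp [mul_comm]
    rw [h1, lintegral_eq_lintegral_measure_lt _ hF.measurable]
    refine lintegral_congr fun s => ?_
    have hm : MeasurableSet {x | ENNReal.ofReal s < F x} :=
      measurableSet_lt measurable_const hF.measurable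
    rw [withDensity_apply _ hm, Measure.restrict_restrict hm]
  rw [key g hg, key _ (rearr_antitone g).measurable]
  refine lintegral_mono fun s => setLIntegral_le_rearr hg
    ((measurableSet_lt measurable_const hF.measurable).inter measurableSet_Ioi)
    inter_subset_right ?_
  rintro x ⟨hx, -⟩ y hy hyx
  exact ⟨lt_of_lt_of_le hx (hF hyx), hy⟩

theorem smul_iterate_RI_le {I : ℝ → ℝ} (hI : MonotoneOn I (Ioi 0))
    (f : ℝ → ℝ≥0∞) (m : ℕ)
    {θ : ℝ} (hθ : 0 < θ) (hθ1 : θ ≤ 1) {b : ℝ} (hb : 0 < b) :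
    ENNReal.ofReal θ ^ m * (RI I)^[m] (rearr f) b ≤ (RI I)^[m] (rearr f) (θ * b) := by
  induction m generalizing b with
  | zero => simpa using rearr_antitone f (mul_le_of_le_one_left hb.le hθ1)
  | succ m ih =>
    rw [Function.iterate_succ_apply']
    set u := (RI I)^[m] (rearr f)
    have hθb : 0 < θ * b := mul_pos hθ hb
    have hcov : ∫⁻ s in Ioc (0 : ℝ) (θ * b), u s =
        ENNReal.ofReal θ * ∫⁻ s in Ioc (0 : ℝ) b, u (θ * s) := by
      have he : MeasurableEmbedding (fun x : ℝ => θ * x) :=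
        (Homeomorph.mulLeft₀ θ hθ.ne').measurableEmbedding
      have hpre : (fun x : ℝ => θ * x) ⁻¹' Ioc 0 (θ * b) = Ioc 0 b := by
        ext x
        simp [mul_pos_iff_of_pos_left hθ, mul_le_mul_iff_right₀ hθ]
      rw [← hpre, ← he.lintegral_map, ← he.restrict_map, ← smul_eq_mul (ENNReal.ofReal θ), ← lintegral_smul_measure,
        ← Measure.restrict_smul]
      conv_lhs => rw [← Real.smul_map_volume_mul_left hθ.ne', abs_of_pos hθ]
    have hle : ENNReal.ofReal θ ^ m * ∫⁻ s in Ioc (0 : ℝ) b, u s ≤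
        ∫⁻ s in Ioc (0 : ℝ) b, u (θ * s) := by
      rw [← lintegral_const_mul' _ _ (by finiteness)]
      refine setLIntegral_mono' measurableSet_Ioc fun s hs => ih hs.1
    simp only [RI]
    rw [hcov, ← mul_div_assoc]
    refine ENNReal.div_le_div ?_ (ENNReal.ofReal_le_ofReal
      (hI hθb hb (mul_le_of_le_one_left hb.le hθ1)))
    rw [pow_succ', mul_assoc]
    gcongr

/-- Cyclic translation by `δ` of the interval `(a, b]`, extended by the identity. -/
def rotate (a b δ x : ℝ) : ℝ :=
  if a < x ∧ x ≤ b then (if x + δ ≤ b then x + δ else x + δ - (b - a)) else x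

theorem measurable_rotate (a b δ : ℝ) : Measurable (rotate a b δ) := by
  refine Measurable.ite (measurableSet_Ioc (a := a) (b := b)) (Measurable.ite ?_ ?_ ?_)
    measurable_id
  · exact measurableSet_le (by fun_prop) measurable_const
  · fun_prop
  · fun_prop

theorem distrib_comp_rotate {g : ℝ → ℝ≥0∞} {a b δ : ℝ} (ha : 0 ≤ a)
    (hδ : 0 ≤ δ) (hδb : δ ≤ b - a) (s : ℝ≥0∞) :
    distrib (fun x => g (rotate a b δ x)) s = distrib g s := by
  set A : Set ℝ := {t : ℝ | t ∈ Ioi (0 : ℝ) ∧ s < g t} with hA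
  set P : Set ℝ := {t : ℝ | t ∈ Ioi (0 : ℝ) ∧ s < g (rotate a b δ t)} with hP
  change volume P = volume A
  rw [← measure_inter_add_sdiff P (measurableSet_Ioc (a := a) (b := b)),
    ← measure_inter_add_sdiff A (measurableSet_Ioc (a := a) (b := b)),
    ← measure_inter_add_sdiff (P ∩ Ioc a b) (measurableSet_Ioc (a := a) (b := b - δ)),
    ← measure_inter_add_sdiff (A ∩ Ioc a b) (measurableSet_Ioc (a := a + δ) (b := b))]
  have h1 : P ∩ Ioc a b ∩ Ioc a (b - δ) = (fun x => x + δ) ⁻¹' (A ∩ Ioc a b ∩ Ioc (a + δ) b) := by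
    ext x
    simp only [hP, hA, mem_inter_iff, mem_ofPred_eq, mem_Ioi, mem_Ioc, mem_preimage]
    constructor
    · rintro ⟨⟨⟨h0, h⟩, h1, h2⟩, h3, h4⟩
      rw [rotate, if_pos ⟨h1, h2⟩, if_pos (by linarith)] at h
      exact ⟨⟨⟨by linarith, h⟩, by linarith, by linarith⟩, by linarith, by linarith⟩
    · rintro ⟨⟨⟨h0, h⟩, h1, h2⟩, h3, h4⟩
      refine ⟨⟨⟨by linarith, ?_⟩, by linarith, by linarith⟩, by linarith, by linarith⟩
      rwa [rotate, if_pos ⟨by linarith, by linarith⟩, if_pos (by linarith)]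
  have h2 : (P ∩ Ioc a b) \ Ioc a (b - δ) =
      (fun x => x + (δ - (b - a))) ⁻¹' ((A ∩ Ioc a b) \ Ioc (a + δ) b) := by
    ext x
    simp only [hP, hA, mem_inter_iff, mem_ofPred_eq, mem_Ioi, mem_Ioc, mem_preimage, Set.mem_sdiff,
      not_and, not_le]
    constructor
    · rintro ⟨⟨⟨h0, h⟩, h1, h2⟩, h3⟩
      have h3 := h3 h1
      rw [rotate, if_pos ⟨h1, h2⟩, if_neg (by linarith), add_sub_assoc] at h
      exact ⟨⟨⟨by linarith, h⟩, by linarith, by linarith⟩, fun h5 => by linarith⟩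
    · rintro ⟨⟨⟨h0, h⟩, h1, h2⟩, h3⟩
      have h4 : x ≤ b := by
        by_contra! hx
        linarith [h3 (by linarith)]
      refine ⟨⟨⟨by linarith, ?_⟩, by linarith, h4⟩, fun _ => by linarith⟩
      rwa [rotate, if_pos ⟨by linarith, h4⟩, if_neg (by linarith), add_sub_assoc]
  have h3 : P \ Ioc a b = A \ Ioc a b := by
    ext x
    simp only [hP, hA, Set.mem_sdiff, mem_ofPred_eq]
    refine and_congr_left fun hx => ?_
    rw [rotate, if_neg (show ¬(a < x ∧ x ≤ b) from hx)]
  rw [h1, h2, h3, measure_preimage_add_right, measure_preimage_add_right]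

theorem sum_rotate (g : ℝ → ℝ≥0∞) {a b δ x : ℝ} {i p : ℕ} (hδ : 0 < δ)
    (hb : b = a + (i + p : ℕ) * δ) (hx : a + i * δ < x) (hx' : x ≤ a + (i + 1) * δ) (hp : 1 ≤ p) :
    ∑ j ∈ Finset.range (i + p), g (rotate a b (j * δ) x) =
      ∑ j ∈ Finset.range (i + p), g (x - i * δ + j * δ) := by
  have hp' : (1 : ℝ) ≤ p := by exact_mod_cast hp
  have hi0 : (0 : ℝ) ≤ i * δ := by positivity
  push_cast at hb
  have hxm : a < x ∧ x ≤ b := ⟨by linarith, by nlinarith⟩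
  rw [Finset.sum_range_add (fun j : ℕ => g (x - i * δ + j * δ)) i p, add_comm i p,
    Finset.sum_range_add _ p i, add_comm]
  congr 1
  · refine Finset.sum_congr rfl fun j hj => ?_
    have hj0 : (0 : ℝ) ≤ j * δ := by positivity
    rw [rotate, if_pos hxm, if_neg]
    · rw [hb]; push_cast; ring_nf
    · push_cast; nlinarith
  · refine Finset.sum_congr rfl fun j hj => ?_
    have hj : (j : ℝ) + 1 ≤ p := by exact_mod_cast Finset.mem_range.1 hj
    rw [rotate, if_pos hxm, if_pos]
    · push_cast; ring_nf
    · nlinarith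

theorem setLIntegral_le_mul_sum {g : ℝ → ℝ≥0∞} (hg : Antitone g) {a δ y : ℝ} (hδ : 0 ≤ δ)
    (hy : y ≤ a + δ) (n : ℕ) :
    ∫⁻ t in Ioc (a + δ) (a + (n + 1) * δ), g t ≤
      ENNReal.ofReal δ * ∑ j ∈ Finset.range n, g (y + j * δ) := by
  induction n with
  | zero => simp
  | succ n ih =>
    have hn : (0 : ℝ) ≤ n * δ := by positivity
    rw [← Ioc_union_Ioc_eq_Ioc (b := a + (n + 1) * δ) (by linarith) (by push_cast; linarith),
      Finset.sum_range_succ, mul_add]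
    refine (lintegral_union_le _ _ _).trans (add_le_add ih ?_)
    calc ∫⁻ t in Ioc (a + (n + 1) * δ) (a + ((n + 1 : ℕ) + 1) * δ), g t
        ≤ ∫⁻ t in Ioc (a + (n + 1) * δ) (a + ((n + 1 : ℕ) + 1) * δ), g (y + n * δ) :=
          setLIntegral_mono' measurableSet_Ioc fun t ht => hg (by linarith [ht.1])
      _ = ENNReal.ofReal δ * g (y + n * δ) := by
          rw [setLIntegral_const, Real.volume_Ioc, mul_comm]
          push_cast
          ring_nf

theorem setLIntegral_le_mul_sum_rotate {g : ℝ → ℝ≥0∞} (hg : Antitone g) {a b x : ℝ}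
    (hx : a < x) (hxb : x ≤ b) {n : ℕ} (hn : 1 ≤ n) :
    ∫⁻ t in Ioc (a + (b - a) / n) b, g t ≤ ENNReal.ofReal ((b - a) / n) *
      ∑ j ∈ Finset.range n, g (rotate a b (j * ((b - a) / n)) x) := by
  have hn0 : (0 : ℝ) < n := by exact_mod_cast hn
  set δ := (b - a) / n with hδd
  have hδ : 0 < δ := div_pos (by linarith) hn0
  have hb : b = a + n * δ := by rw [hδd]; field_simp; ring
  have hq : 0 < (x - a) / δ := div_pos (by linarith) hδ
  obtain ⟨i, hi⟩ : ∃ i, ⌈(x - a) / δ⌉₊ = i + 1 :=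
    Nat.exists_eq_add_of_le' (Nat.ceil_pos.2 hq)
  obtain ⟨h1, h2⟩ := (Nat.ceil_eq_iff (Nat.succ_ne_zero i)).1 hi
  rw [lt_div_iff₀ hδ] at h1
  rw [div_le_iff₀ hδ] at h2
  push_cast at h1 h2
  have hin : i < n := by
    have : (i : ℝ) < n := lt_of_mul_lt_mul_right (by linarith : (i : ℝ) * δ < n * δ) hδ.le
    exact_mod_cast this
  obtain ⟨p, rfl⟩ := Nat.exists_eq_add_of_le hin.le
  rw [sum_rotate g hδ hb (by linarith) (by linarith) (by omega)]
  refine le_trans (lintegral_mono_set (Ioc_subset_Ioc_right ?_))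
    (setLIntegral_le_mul_sum hg hδ.le (y := x - i * δ) (by linarith) (i + p))
  rw [add_mul]
  linarith

theorem N_finsetSum_le (X : RIBanachFunctionNorm) {ι : Type*} (S : Finset ι) (g : ι → ℝ → ℝ≥0∞)
    (hg : ∀ i, Measurable (g i)) :
    X.N (fun t => ∑ i ∈ S, g i t) ≤ ∑ i ∈ S, X.N (g i) := by
  classical
  induction S using Finset.induction_on with
  | empty =>
    simp only [Finset.sum_empty, nonpos_iff_eq_zero]
    exact (X.eq_zero_iff _ measurable_const).2 (Eventually.of_forall fun _ => rfl)
  | insert i S hi ih =>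
    simp only [Finset.sum_insert hi]
    exact (X.add_le _ _ (hg i) (Finset.measurable_fun_sum S fun j _ => hg j)).trans (by gcongr)

/-- The function `g` with its values on `(a, b]` replaced by its mean there. -/
def averageOn (a b : ℝ) (g : ℝ → ℝ≥0∞) (t : ℝ) : ℝ≥0∞ :=
  if a < t ∧ t ≤ b then (∫⁻ s in Ioc a b, g s) / ENNReal.ofReal (b - a) else g t

theorem measurable_ite_Ioc {g : ℝ → ℝ≥0∞} (hg : Measurable g) (a b : ℝ) (c : ℝ≥0∞) :
    Measurable fun t => if a < t ∧ t ≤ b then c else g t :=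
  Measurable.ite (measurableSet_Ioc (a := a) (b := b)) measurable_const hg

theorem averageOn_antitone {g : ℝ → ℝ≥0∞} (hg : Antitone g) {a b : ℝ} (hab : a < b) :
    Antitone (averageOn a b g) := by
  have hL0 : ENNReal.ofReal (b - a) ≠ 0 := by simpa using hab
  have hle : (∫⁻ s in Ioc a b, g s) / ENNReal.ofReal (b - a) ≤ g a := by
    refine ENNReal.div_le_of_le_mul ?_
    rw [← Real.volume_Ioc, ← setLIntegral_const]
    exact setLIntegral_mono' measurableSet_Ioc fun t ht => hg ht.1.le
  have hge : g b ≤ (∫⁻ s in Ioc a b, g s) / ENNReal.ofReal (b - a) := by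
    rw [ENNReal.le_div_iff_mul_le (Or.inl hL0) (Or.inl ENNReal.ofReal_ne_top),
      ← Real.volume_Ioc, ← setLIntegral_const]
    exact setLIntegral_mono' measurableSet_Ioc fun t ht => hg ht.2
  intro x y hxy
  simp only [averageOn]
  split_ifs with h1 h2 h2
  · exact le_rfl
  · have : x ≤ a := by
      by_contra! hx
      exact h2 ⟨hx, hxy.trans h1.2⟩
    exact hle.trans (hg this)
  · have : b ≤ y := by
      by_contra! hy
      exact h1 ⟨h2.1.trans_le hxy, hy.le⟩
    exact (hg this).trans hge
  · exact hg hxy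

theorem norm_averageOn_le (X : RIBanachFunctionNorm) {g : ℝ → ℝ≥0∞} (hg : Antitone g)
    {a b : ℝ} (ha : 0 ≤ a) (hab : a < b) : X.N (averageOn a b g) ≤ X.N g := by
  have hgm := hg.measurable
  have hL : 0 < b - a := sub_pos.2 hab
  have hset : Ioc a b = ⋃ n : ℕ, Ioc (a + (b - a) / (n + 1 : ℕ)) b := by
    ext x
    simp only [mem_iUnion, mem_Ioc, exists_and_right]
    refine and_congr_left fun hxb => ⟨fun hx => ?_, ?_⟩
    · obtain ⟨n, hn⟩ := exists_nat_gt ((b - a) / (x - a))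
      have hx0 : 0 < x - a := sub_pos.2 hx
      refine ⟨n, ?_⟩
      rw [div_lt_iff₀ hx0] at hn
      have : (b - a) / (n + 1 : ℕ) < x - a := by
        rw [div_lt_iff₀ (by positivity)]
        push_cast
        linarith
      linarith
    · rintro ⟨n, hn⟩
      have : 0 ≤ (b - a) / (n + 1 : ℕ) := by positivity
      linarith
  have hmono : Monotone fun n : ℕ => Ioc (a + (b - a) / (n + 1 : ℕ)) b := by
    intro i j hij
    refine Ioc_subset_Ioc_left ?_
    gcongr
  set c : ℕ → ℝ≥0∞ := fun n =>
    (∫⁻ s in Ioc (a + (b - a) / (n + 1 : ℕ)) b, g s) / ENNReal.ofReal (b - a) with hc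
  have hcmono : Monotone c := fun i j hij =>
    ENNReal.div_le_div_right (lintegral_mono_set (hmono hij)) _
  have hcsup : (∫⁻ s in Ioc a b, g s) / ENNReal.ofReal (b - a) = ⨆ n, c n := by
    rw [hset, setLIntegral_iUnion_of_directed _ hmono.directed_le, ENNReal.iSup_div]
  rw [X.fatou (fun n t => if a < t ∧ t ≤ b then c n else g t) (averageOn a b g)
    (fun n => measurable_ite_Ioc hgm a b _) (averageOn_antitone hg hab).measurable
    (Eventually.of_forall fun t => ?_) (Eventually.of_forall fun t => ?_)]
  · refine iSup_le fun n => ?_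
    have hn0 : ((n + 1 : ℕ) : ℝ≥0) ≠ 0 := by positivity
    calc X.N (fun t => if a < t ∧ t ≤ b then c n else g t)
        ≤ X.N (fun t => ((((n + 1 : ℕ) : ℝ≥0)⁻¹ : ℝ≥0) : ℝ≥0∞) *
          ∑ j ∈ Finset.range (n + 1), g (rotate a b (j * ((b - a) / (n + 1 : ℕ))) t)) := by
          refine X.mono _ _ (measurable_ite_Ioc hgm a b _) ?_ (Eventually.of_forall fun t => ?_)
          · exact (Finset.measurable_fun_sum _ fun j _ =>
              hgm.comp (measurable_rotate _ _ _)).const_mul _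
          · split_ifs with ht
            · refine ENNReal.div_le_of_le_mul ?_
              refine (setLIntegral_le_mul_sum_rotate hg ht.1 ht.2
                (Nat.le_add_left 1 n)).trans (le_of_eq ?_)
              rw [ENNReal.ofReal_div_of_pos (by positivity), ENNReal.coe_inv hn0, div_eq_mul_inv,
                ENNReal.ofReal_natCast, ENNReal.coe_natCast]
              ring
            · simp only [rotate, if_neg ht, Finset.sum_const, Finset.card_range, nsmul_eq_mul]
              rw [← mul_assoc, ENNReal.coe_inv hn0, ENNReal.coe_natCast,
                ENNReal.inv_mul_cancel (by simp) (by simp), one_mul]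
      _ = ((((n + 1 : ℕ) : ℝ≥0)⁻¹ : ℝ≥0) : ℝ≥0∞) * X.N (fun t =>
          ∑ j ∈ Finset.range (n + 1), g (rotate a b (j * ((b - a) / (n + 1 : ℕ))) t)) :=
          X.smul _ _ (Finset.measurable_fun_sum _ fun j _ => hgm.comp (measurable_rotate _ _ _))
      _ ≤ ((((n + 1 : ℕ) : ℝ≥0)⁻¹ : ℝ≥0) : ℝ≥0∞) *
          ∑ j ∈ Finset.range (n + 1), X.N g := by
          gcongr
          refine (N_finsetSum_le X _ _ fun j => hgm.comp (measurable_rotate _ _ _)).trans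
            (Finset.sum_le_sum fun j hj => le_of_eq ?_)
          refine X.ri _ _ (hgm.comp (measurable_rotate _ _ _)) hgm
            (distrib_comp_rotate ha (by positivity) ?_)
          have hj : (j : ℝ) ≤ (n + 1 : ℕ) := by exact_mod_cast (Finset.mem_range.1 hj).le
          calc j * ((b - a) / (n + 1 : ℕ)) ≤ (n + 1 : ℕ) * ((b - a) / (n + 1 : ℕ)) := by gcongr
            _ = b - a := by field_simp
      _ = X.N g := by
          rw [Finset.sum_const, Finset.card_range, nsmul_eq_mul, ← mul_assoc,
            ENNReal.coe_inv hn0, ENNReal.coe_natCast,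
            ENNReal.inv_mul_cancel (by simp) (by simp), one_mul]
  · intro i j hij
    dsimp only
    split_ifs
    exacts [hcmono hij, le_rfl]
  · simp only [averageOn]
    split_ifs
    exacts [hcsup, ciSup_const.symm]

/-- The least non-increasing function whose value at each `s ∈ S` is at least `h s`. -/
def stepMax (h : ℝ → ℝ≥0∞) (S : Finset ℝ) (t : ℝ) : ℝ≥0∞ :=
  ⨆ s ∈ S, ⨆ _ : t ≤ s, h s

theorem stepMax_antitone (h : ℝ → ℝ≥0∞) (S : Finset ℝ) : Antitone (stepMax h S) := fun _ _ hxy =>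
  iSup₂_mono fun _ _ => iSup_mono' fun hy => ⟨hxy.trans hy, le_rfl⟩

theorem stepMax_mono (h : ℝ → ℝ≥0∞) {S T : Finset ℝ} (hST : S ⊆ T) (t : ℝ) :
    stepMax h S t ≤ stepMax h T t :=
  biSup_mono fun _ hs => hST hs

/-- Averaging `g` over the intervals of constancy of `stepMax h S` transfers its integral against
`stepMax h S` to an integral against `h`. -/
theorem exists_antitone_lintegral_le (X : RIBanachFunctionNorm) {h : ℝ → ℝ≥0∞} {κ : ℝ≥0∞}
    (hh : ∀ a b : ℝ, 0 ≤ a → a < b → κ * (h b * ENNReal.ofReal (b - a)) ≤ ∫⁻ t in Ioc a b, h t)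
    (S : Finset ℝ) {a : ℝ} (ha : 0 ≤ a) (hS : ∀ s ∈ S, a < s) {g : ℝ → ℝ≥0∞} (hg : Antitone g) :
    ∃ k : ℝ → ℝ≥0∞, Antitone k ∧ (∀ t ≤ a, k t = g t) ∧ X.N k ≤ X.N g ∧
      κ * ∫⁻ t in Ioi a, stepMax h S t * g t ≤ ∫⁻ t in Ioi a, h t * k t := by
  induction S using Finset.strongInduction generalizing a g with
  | H S ih =>
    rcases S.eq_empty_or_nonempty with rfl | hne
    · exact ⟨g, hg, fun _ _ => rfl, le_rfl, by simp [stepMax]⟩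
    obtain ⟨b, hbS, hbmax⟩ := S.exists_max_image h hne
    have hab : a < b := hS b hbS
    have hL0 : ENNReal.ofReal (b - a) ≠ 0 := by simpa using hab
    obtain ⟨k, hk, hkg, hkN, hkint⟩ := ih (S.filter (b < ·))
      (Finset.filter_ssubset.2 ⟨b, hbS, lt_irrefl b⟩) (ha.trans hab.le)
      (fun s hs => (Finset.mem_filter.1 hs).2) (averageOn_antitone hg hab)
    refine ⟨k, hk, fun t ht => ?_, hkN.trans (norm_averageOn_le X hg ha hab), ?_⟩
    · rw [hkg t (ht.trans hab.le), averageOn, if_neg fun h => h.1.not_ge ht]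
    have hsplit : ∀ w : ℝ → ℝ≥0∞, ∫⁻ t in Ioi a, w t =
        (∫⁻ t in Ioc a b, w t) + ∫⁻ t in Ioi b, w t := fun w => by
      rw [← Ioc_union_Ioi_eq_Ioi hab.le, lintegral_union measurableSet_Ioi]
      exact Set.disjoint_left.2 fun t ht ht' => ht.2.not_gt ht'
    rw [hsplit, hsplit, mul_add]
    refine add_le_add ?_ (le_trans (mul_le_mul_right ?_ κ) hkint)
    · set c := (∫⁻ s in Ioc a b, g s) / ENNReal.ofReal (b - a) with hc
      calc κ * ∫⁻ t in Ioc a b, stepMax h S t * g t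
          ≤ κ * ∫⁻ t in Ioc a b, h b * g t := by
            gcongr with t
            exact iSup₂_le fun s hs => iSup_le fun _ => hbmax s hs
        _ = κ * (h b * ENNReal.ofReal (b - a)) * c := by
            rw [lintegral_const_mul _ hg.measurable, mul_assoc, mul_assoc, hc,
              ENNReal.mul_div_cancel hL0 ENNReal.ofReal_ne_top]
        _ ≤ (∫⁻ t in Ioc a b, h t) * c := by gcongr; exact hh a b ha hab
        _ ≤ ∫⁻ t in Ioc a b, h t * c := lintegral_mul_const_le _ _
        _ = ∫⁻ t in Ioc a b, h t * k t := by
            refine setLIntegral_congr_fun measurableSet_Ioc fun t ht => ?_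
            rw [hkg t ht.2, averageOn, if_pos ⟨ht.1, ht.2⟩]
    · refine setLIntegral_mono' measurableSet_Ioi fun t ht => ?_
      rw [averageOn, if_neg fun h => h.2.not_gt ht]
      gcongr
      exact iSup₂_le fun s hs => iSup_le fun hts => le_iSup₂_of_le s
        (Finset.mem_filter.2 ⟨hs, lt_of_lt_of_le ht hts⟩) (le_iSup_of_le hts le_rfl)

theorem lintegral_mul_le_downAssocNorm (X : RIBanachFunctionNorm) (h : ℝ → ℝ≥0∞)
    {k : ℝ → ℝ≥0∞} (hk : Antitone k) (hkN : X.N k ≤ 1) :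
    ∫⁻ t in Ioi (0 : ℝ), h t * k t ≤ downAssocNorm X h := by
  refine le_trans (lintegral_mono_ae ?_) (le_iSup_of_le k (le_iSup₂_of_le hk.measurable hkN le_rfl))
  filter_upwards [le_rearr_of_antitone hk] with t ht
  gcongr

theorem half_pow_mul_le_setLIntegral {h : ℝ → ℝ≥0∞} {m : ℕ}
    (hh : ∀ θ : ℝ, 0 < θ → θ ≤ 1 → ∀ b : ℝ, 0 < b → ENNReal.ofReal θ ^ m * h b ≤ h (θ * b))
    {a b : ℝ} (ha : 0 ≤ a) (hab : a < b) :
    (2 ^ (m + 1))⁻¹ * (h b * ENNReal.ofReal (b - a)) ≤ ∫⁻ t in Ioc a b, h t := by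
  have hb : 0 < b := ha.trans_lt hab
  calc (2 ^ (m + 1))⁻¹ * (h b * ENNReal.ofReal (b - a))
      = ∫⁻ t in Ioc ((a + b) / 2) b, ENNReal.ofReal (1 / 2) ^ m * h b := by
        rw [setLIntegral_const, Real.volume_Ioc,
          show b - (a + b) / 2 = (1 / 2) * (b - a) by ring, ENNReal.ofReal_mul (by norm_num),
          one_div, ENNReal.ofReal_inv_of_pos two_pos, ENNReal.ofReal_ofNat, ENNReal.inv_pow, pow_succ]
        ring
    _ ≤ ∫⁻ t in Ioc ((a + b) / 2) b, h t := by
        refine setLIntegral_mono' measurableSet_Ioc fun t ht => ?_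
        have ht0 : 0 < t := by linarith [ht.1]
        have := hh (t / b) (div_pos ht0 hb) ((div_le_one hb).2 ht.2) b hb
        rw [div_mul_cancel₀ _ hb.ne'] at this
        refine le_trans ?_ this
        gcongr ENNReal.ofReal ?_ ^ _ * _
        rw [div_le_div_iff₀ two_pos hb]
        linarith [ht.1]
    _ ≤ ∫⁻ t in Ioc a b, h t := lintegral_mono_set (Ioc_subset_Ioc_left (by linarith))

/-- Up to a null set, the least non-increasing majorant of `h` is an increasing limit of functions
`stepMax h S`. -/
theorem exists_monotone_iSup_le_stepMax {h : ℝ → ℝ≥0∞} {m : ℕ}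
    (hh : ∀ θ : ℝ, 0 < θ → θ ≤ 1 → ∀ b : ℝ, 0 < b → ENNReal.ofReal θ ^ m * h b ≤ h (θ * b)) :
    ∃ S : ℕ → Finset ℝ, Monotone S ∧ (∀ n, ∀ s ∈ S n, 0 < s) ∧
      ∀ᵐ t ∂(volume.restrict (Ioi (0 : ℝ))), ⨆ s ∈ Ici t, h s ≤ ⨆ n, stepMax h (S n) t := by
  obtain ⟨d, hd⟩ := exists_surjective_nat {q : ℚ // 0 < q}
  set S : ℕ → Finset ℝ := fun n => (Finset.range n).image fun i => ((d i : ℚ) : ℝ)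
  refine ⟨S, fun i j hij => Finset.image_subset_image (Finset.range_mono hij), ?_, ?_⟩
  · intro n s hs
    obtain ⟨i, -, rfl⟩ := Finset.mem_image.1 hs
    exact_mod_cast (d i).2
  set G : ℝ → ℝ≥0∞ := fun t => ⨆ n, stepMax h (S n) t with hG
  have hGanti : Antitone G := fun x y hxy => iSup_mono fun n => stepMax_antitone h _ hxy
  have hq : ∀ (q : ℚ) (t : ℝ), 0 < q → t ≤ q → h q ≤ G t := by
    intro q t hq0 hqt
    obtain ⟨i, hi⟩ := hd ⟨q, hq0⟩
    refine le_iSup_of_le (i + 1) (le_iSup₂_of_le (q : ℝ) ?_ (le_iSup_of_le hqt le_rfl))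
    exact Finset.mem_image.2 ⟨i, by simp, by rw [hi]⟩
  have key : ∀ t' t s : ℝ, 0 < t' → t' < t → t ≤ s → h s ≤ G t' := by
    intro t' t s ht' htt hts
    have hs : 0 < s := by linarith
    have hlim : Tendsto (fun θ : ℝ => ENNReal.ofReal θ ^ m * h s) (𝓝[<] 1) (𝓝 (h s)) := by
      have h1 : Tendsto (fun θ : ℝ => ENNReal.ofReal θ ^ m) (𝓝[<] 1) (𝓝 1) := by
        have : ContinuousAt (fun θ : ℝ => ENNReal.ofReal θ ^ m) 1 :=
          ((ENNReal.continuous_pow m).comp ENNReal.continuous_ofReal).continuousAt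
        simpa using this.tendsto.mono_left nhdsWithin_le_nhds
      simpa using ENNReal.Tendsto.mul_const h1 (Or.inl one_ne_zero)
    refine le_of_tendsto hlim ?_
    filter_upwards [Ioo_mem_nhdsLT zero_lt_one] with θ hθ
    obtain ⟨q, hq1, hq2⟩ := exists_rat_btwn
      (max_lt (htt.trans_le hts) (mul_lt_of_lt_one_left hs hθ.2) : max t' (θ * s) < s)
    have hq0 : (0 : ℝ) < q := ht'.trans ((le_max_left _ _).trans_lt hq1)
    have h2 := hh (q / s) (div_pos hq0 hs) ((div_le_one hs).2 hq2.le) s hs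
    rw [div_mul_cancel₀ _ hs.ne'] at h2
    refine le_trans ?_ (h2.trans (hq q t' (by exact_mod_cast hq0)
      ((le_max_left _ _).trans hq1.le)))
    gcongr
    rw [le_div_iff₀ hs]
    exact (le_max_right _ _).trans hq1.le
  have hc : ∀ᵐ t : ℝ, ContinuousAt G t := by
    have := hGanti.countable_not_continuousAt.measure_zero volume
    simpa [ae_iff] using this
  filter_upwards [ae_restrict_of_ae hc, ae_restrict_mem measurableSet_Ioi] with t ht ht0
  refine ge_of_tendsto (ht.tendsto.mono_left nhdsWithin_le_nhds : Tendsto G (𝓝[<] t) _) ?_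
  filter_upwards [Ioo_mem_nhdsLT ht0] with t' ht'
  exact iSup₂_le fun s hs => key t' t s ht'.1 ht'.2 hs

/-- Norm equivalence between `R_I^m f*` and `G_I^m f` in the
associate and down-associate norms. -/
theorem statement2 (m : ℕ) (hm : 1 ≤ m) (I : ℝ → ℝ)
    (hI : MonotoneOn I (Set.Ioi 0))
    (hIpos : ∀ t ∈ Set.Ioi (0 : ℝ), 0 < I t)
    (hIlc : ∀ t ∈ Set.Ioi (0 : ℝ), Filter.Tendsto I (𝓝[<] t) (𝓝 (I t)))
    (hPhi : EssentiallyDecreasingIn I m)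
    (X : RIBanachFunctionNorm) (f : ℝ → ℝ≥0∞) (hf : Measurable f) :
    downAssocNorm X ((RI I)^[m] (rearr f)) ≤ assocNorm X ((RI I)^[m] (rearr f)) ∧
    assocNorm X ((RI I)^[m] (rearr f)) ≤ assocNorm X (GI I m f) ∧
    assocNorm X (GI I m f) ≤ 2 ^ (m + 1) * downAssocNorm X ((RI I)^[m] (rearr f)) := by
  set h := (RI I)^[m] (rearr f)
  have hh : ∀ θ : ℝ, 0 < θ → θ ≤ 1 → ∀ b : ℝ, 0 < b →
      ENNReal.ofReal θ ^ m * h b ≤ h (θ * b) :=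
    fun θ hθ hθ1 b hb => smul_iterate_RI_le hI f m hθ hθ1 hb
  have hGanti : Antitone (GI I m f) := fun x y hxy => biSup_mono fun s hs => hxy.trans hs
  refine ⟨?_, ?_, ?_⟩
  · refine iSup_le fun g => iSup₂_le fun hg hgN => ?_
    exact le_iSup_of_le (rearr g) (le_iSup₂_of_le (rearr_antitone g).measurable
      ((norm_rearr X hg).trans_le hgN) le_rfl)
  · refine iSup_mono fun g => iSup₂_mono fun _ _ => lintegral_mono fun t => ?_
    gcongr
    exact le_iSup₂_of_le t self_mem_Ici le_rfl
  · refine iSup_le fun g => iSup₂_le fun hg hgN => ?_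
    refine (lintegral_mul_le_lintegral_mul_rearr hGanti hg).trans ?_
    have hg' := rearr_antitone g
    obtain ⟨S, hSmono, hSpos, hSle⟩ := exists_monotone_iSup_le_stepMax hh
    calc ∫⁻ t in Ioi (0 : ℝ), GI I m f t * rearr g t
        ≤ ∫⁻ t in Ioi (0 : ℝ), ⨆ n, stepMax h (S n) t * rearr g t := by
          refine lintegral_mono_ae ?_
          filter_upwards [hSle] with t ht
          rw [← ENNReal.iSup_mul]
          gcongr
          exact ht
      _ = ⨆ n, ∫⁻ t in Ioi (0 : ℝ), stepMax h (S n) t * rearr g t :=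
          lintegral_iSup (fun n => (stepMax_antitone h (S n)).measurable.mul hg'.measurable)
            fun i j hij t => mul_le_mul_left (stepMax_mono h (hSmono hij) t) _
      _ ≤ 2 ^ (m + 1) * downAssocNorm X h := by
          refine iSup_le fun n => ?_
          obtain ⟨k, hk, -, hkN, hkint⟩ := exists_antitone_lintegral_le X
            (fun a b => half_pow_mul_le_setLIntegral hh) (S n) le_rfl (hSpos n) hg'
          rw [mul_comm, ← ENNReal.div_le_iff (by positivity) (by finiteness), div_eq_mul_inv,
            mul_comm]
          exact hkint.trans (lintegral_mul_le_downAssocNorm X h hk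
            (hkN.trans ((norm_rearr X hg).trans_le hgN)))
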